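/- arXiv:math/0406272 — 2 statements merged into one kernel-verified Lean document; each statement's English description precedes it below -/
import Mathlib

section
/- Let k be an algebraically closed field of characteristic zero and let V be a k-vector space of finite dimension n ≥ 2. Let Sym denote the k-vector space of symmetric bilinear forms on V; it has dimension N = n(n+1)/2, and SL(V) acts linearly on Sym by (g·B)(x,y) = B(g⁻¹x, g⁻¹y). Then there exists a complete flag 0 = W₀ ⊂ W₁ ⊂ ⋯ ⊂ W_N = Sym of linear subspaces with dim Wᵢ = i for all i, such that the subgroup {g ∈ SL(V) : g·Wᵢ = Wᵢ for all i = 0,…,N} of SL(V) is finite. -/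
/-- The space of symmetric bilinear forms on `V`, as a submodule of `V →ₗ[k] V →ₗ[k] k`. -/
def symBilinForms (k V : Type*) [Field k] [AddCommGroup V] [Module k V] :
    Submodule k (V →ₗ[k] V →ₗ[k] k) where
  carrier := {B | ∀ x y : V, B x y = B y x}
  add_mem' := by
    intro B₁ B₂ h₁ h₂ x y
    simp [h₁ x y, h₂ x y]
  zero_mem' := by intro x y; simp
  smul_mem' := by
    intro c B hB x y
    simp [hB x y]

/-- The natural action of a linear automorphism `g` of `V` on bilinear forms:
`(g · B)(x, y) = B(g⁻¹ x, g⁻¹ y)`. -/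
def bilinFormAction {k V : Type*} [Field k] [AddCommGroup V] [Module k V]
    (g : V ≃ₗ[k] V) (B : V →ₗ[k] V →ₗ[k] k) : V →ₗ[k] V →ₗ[k] k :=
  B.compl₁₂ (g.symm : V →ₗ[k] V) (g.symm : V →ₗ[k] V)

open Module

/-- A symmetric bilinear form is determined by its values on unordered pairs of basis vectors. -/
noncomputable def symBilinFormsEquivSym2 {k V ι : Type*} [Field k] [AddCommGroup V] [Module k V]
    [Fintype ι] [DecidableEq ι] (e : Basis ι k V) : symBilinForms k V ≃ₗ[k] (Sym2 ι → k) where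
  toFun B s := Sym2.lift ⟨fun i j => B.1 (e i) (e j), fun _ _ => B.2 _ _⟩ s
  map_add' B C := by
    ext s
    induction s with | _ i j => simp
  map_smul' c B := by
    ext s
    induction s with | _ i j => simp
  invFun f := ⟨Matrix.toLinearMap₂ e e (Matrix.of fun i j => f s(i, j)), by
    suffices h : Matrix.toLinearMap₂ e e (Matrix.of fun i j => f s(i, j)) =
        (Matrix.toLinearMap₂ e e (Matrix.of fun i j => f s(i, j))).flip from
      fun x y => LinearMap.congr_fun₂ h x y
    refine LinearMap.ext_basis e e fun i j => ?_
    rw [LinearMap.flip_apply, Matrix.toLinearMap₂_apply_basis, Matrix.toLinearMap₂_apply_basis,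
      Matrix.of_apply, Matrix.of_apply, Sym2.eq_swap]⟩
  left_inv B := by
    exact Subtype.ext (LinearMap.ext_basis e e fun i j =>
      Matrix.toLinearMap₂_apply_basis e e _ i j)
  right_inv f := by
    ext s
    induction s with | _ i j => exact Matrix.toLinearMap₂_apply_basis e e _ i j

theorem Module.Basis.finrank_flag {k M : Type*} [Field k] [AddCommGroup M] [Module k M] {n : ℕ}
    (b : Basis (Fin n) k M) (i : Fin (n + 1)) : finrank k (b.flag i) = i := by
  have hs : Set.range (b ∘ (Subtype.val : {j : Fin n // j.castSucc < i} → Fin n)) =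
      b '' {j | j.castSucc < i} := by
    ext
    simp
  rw [Module.Basis.flag, ← hs,
    finrank_span_eq_card (b.linearIndependent.comp _ Subtype.val_injective),
    Fintype.card_subtype]
  simp only [Fin.lt_def, Fin.val_castSucc, Fin.card_filter_val_lt]
  omega

/-- Two independent vectors are the first two members of some basis. -/
theorem exists_basis_fin_extending_pair {k M : Type*} [Field k] [AddCommGroup M] [Module k M]
    [FiniteDimensional k M] {x y : M} (h : LinearIndependent k ![x, y]) {m : ℕ}
    (hm : finrank k M = 2 + m) :
    ∃ b : Basis (Fin (2 + m)) k M, b (Fin.castAdd m 0) = x ∧ b (Fin.castAdd m 1) = y := by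
  let b := Basis.sumExtend h
  have : Finite (Fin 2 ⊕ Basis.sumExtendIndex h) := Module.Finite.finite_basis b
  have : Finite (Basis.sumExtendIndex h) := Finite.of_injective _ (Sum.inr_injective (α := Fin 2))
  have hc : Nat.card (Basis.sumExtendIndex h) = m := by
    have := finrank_eq_nat_card_basis b
    rw [Nat.card_sum, Nat.card_fin] at this
    omega
  let e := Finite.equivFinOfCardEq hc
  have hb (i : Fin 2) : b (Sum.inl i) = ![x, y] i := by
    simp only [b, Basis.sumExtend, Basis.reindex_apply, Basis.extend_apply_self]
    rfl
  refine ⟨b.reindex ((Equiv.sumCongr (Equiv.refl _) e).trans finSumFinEquiv), ?_, ?_⟩ <;>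
    simp [Basis.reindex_apply, hb]

/-- The image of a space under an injective linear map has a complete flag through any pair of
independent vectors. Only the source is required to be a group, which keeps the unification of
module structures cheap when the target is a space of linear maps. -/
theorem exists_completeFlag_through_pair {k E F : Type*} [Field k] [AddCommMonoid E] [Module k E]
    [AddCommGroup F] [Module k F] [FiniteDimensional k F] {f : F →ₗ[k] E}
    (hf : Function.Injective f) {x y : F} (h : ∀ s t : k, s • x + t • y = 0 → s = 0 ∧ t = 0)
    {N : ℕ} (hN : finrank k F = N) :
    ∃ W : Fin (N + 1) → Submodule k E, (∀ i, W i ≤ LinearMap.range f) ∧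
      (∀ i j, i ≤ j → W i ≤ W j) ∧ (∀ i : Fin (N + 1), finrank k (W i) = (i : ℕ)) ∧
      W (Fin.last N) = LinearMap.range f ∧
      (∃ i, W i = Submodule.span k {f x}) ∧ ∃ i, W i = Submodule.span k {f x, f y} := by
  have hli : LinearIndependent k ![x, y] := LinearIndependent.pair_iff.2 h
  obtain ⟨m, rfl⟩ : ∃ m, N = 2 + m := by
    have := hli.fintype_card_le_finrank
    rw [hN, Fintype.card_fin] at this
    exact ⟨N - 2, by omega⟩
  obtain ⟨b, hb₀, hb₁⟩ := exists_basis_fin_extending_pair hli hN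
  refine ⟨fun i => (b.flag i).map f, fun i => LinearMap.map_le_range,
    fun i j hij => Submodule.map_mono (b.flag_mono hij), fun i => ?_, ?_,
    ⟨⟨1, by omega⟩, ?_⟩, ⟨2, by omega⟩, ?_⟩
  · rw [← b.finrank_flag i]
    exact (Submodule.equivMapOfInjective f hf (b.flag i)).finrank_eq.symm
  · simp only [Module.Basis.flag_last, Submodule.map_top]
  · have hs : {i : Fin (2 + m) | i.castSucc < ⟨1, by omega⟩} = {Fin.castAdd m 0} := by
      ext i
      simp only [Set.mem_ofPred_eq, Set.mem_singleton_iff, Fin.lt_def,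
        Fin.ext_iff, Fin.val_castSucc, Fin.val_castAdd, Fin.val_zero]
      omega
    simp only [Module.Basis.flag, hs, Submodule.map_span, Set.image_singleton, hb₀]
  · have hs : {i : Fin (2 + m) | i.castSucc < ⟨2, by omega⟩} =
        {Fin.castAdd m 0, Fin.castAdd m 1} := by
      ext i
      simp only [Set.mem_ofPred_eq, Set.mem_insert_iff, Set.mem_singleton_iff, Fin.lt_def,
        Fin.ext_iff, Fin.val_castSucc, Fin.val_castAdd, Fin.val_zero, Fin.val_one]
      omega
    simp only [Module.Basis.flag, hs, Submodule.map_span, Set.image_pair, hb₀, hb₁]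

/-- The matrices scaling the standard form and preserving its pencil with a diagonal form of
distinct entries: each entry is zero or a square root of the scaling factor. -/
theorem entry_eq_zero_or_sq_eq {k ι : Type*} [Field k] [Fintype ι] [DecidableEq ι]
    {d : ι → k} (hd : Function.Injective d) {M : Matrix ι ι k} {a b c : k} (hc : c ≠ 0)
    (h₁ : M.transpose * M = c • (1 : Matrix ι ι k))
    (h₂ : M.transpose * Matrix.diagonal d * M = a • (1 : Matrix ι ι k) + b • Matrix.diagonal d)
    (i j : ι) : M i j = 0 ∨ M i j ^ 2 = c := by
  have h₃ : M * M.transpose = c • (1 : Matrix ι ι k) := by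
    have h : (c⁻¹ • M.transpose) * M = 1 := by
      rw [Matrix.smul_mul, h₁, smul_smul, inv_mul_cancel₀ hc, one_smul]
    have h' := mul_eq_one_comm.1 h
    rw [Matrix.mul_smul] at h'
    rw [← h', smul_smul, mul_inv_cancel₀ hc, one_smul]
  have h₄ : c • (Matrix.diagonal d * M) = a • M + b • (M * Matrix.diagonal d) := by
    have := congrArg (M * ·) h₂
    simpa [← Matrix.mul_assoc, h₃, Matrix.mul_add] using this
  have h₅ (l : ι) : c * (d l * M l j) = a * M l j + b * (M l j * d j) := by
    simpa using congrFun (congrFun h₄ l) j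
  by_cases hij : M i j = 0
  · exact Or.inl hij
  right
  have hz : ∀ l, l ≠ i → M l j = 0 := by
    intro l hl
    by_contra hlj
    refine hl (hd (mul_left_cancel₀ hc (?_ : c * d l = c * d i)))
    have e₁ : c * d l = a + b * d j := mul_right_cancel₀ hlj (by linear_combination h₅ l)
    have e₂ : c * d i = a + b * d j := mul_right_cancel₀ hij (by linear_combination h₅ i)
    rw [e₁, e₂]
  have h₆ := congrFun (congrFun h₁ j) j
  rw [Matrix.mul_apply, Finset.sum_eq_single i (fun l _ hl => by simp [hz l hl]) (by simp)] at h₆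
  simpa [sq] using h₆

theorem smul_one_add_smul_diagonal_eq_zero {k ι : Type*} [Field k] [Nontrivial ι] [DecidableEq ι]
    {d : ι → k} (hd : Function.Injective d) :
    ∀ s t : k, s • (1 : Matrix ι ι k) + t • Matrix.diagonal d = 0 → s = 0 ∧ t = 0 := by
  intro s t hst
  obtain ⟨i, j, hij⟩ := exists_pair_ne ι
  have hi : s + t * d i = 0 := by simpa using congrFun (congrFun hst i) i
  have hj : s + t * d j = 0 := by simpa using congrFun (congrFun hst j) j
  have ht : t = 0 := by
    have : t * (d i - d j) = 0 := by linear_combination hi - hj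
    exact (mul_eq_zero.1 this).resolve_right (sub_ne_zero.2 (hd.ne hij))
  exact ⟨by simpa [ht] using hi, ht⟩

/-- Only finitely many unimodular automorphisms preserve the line of the standard form and its
pencil with a diagonal form of distinct entries. -/
theorem finite_stabilizer_diagonal_pencil {k V ι : Type*} [Field k] [AddCommGroup V] [Module k V]
    [Fintype ι] [Nonempty ι] [DecidableEq ι] (e : Basis ι k V) {d : ι → k}
    (hd : Function.Injective d) {B₁ B₂ : V →ₗ[k] V →ₗ[k] k}
    (hB₁ : LinearMap.toMatrix₂ e e B₁ = 1) (hB₂ : LinearMap.toMatrix₂ e e B₂ = Matrix.diagonal d) :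
    {g : V ≃ₗ[k] V | LinearMap.det (g : V →ₗ[k] V) = 1 ∧
      bilinFormAction g B₁ ∈ Submodule.span k {B₁} ∧
      bilinFormAction g B₂ ∈ Submodule.span k {B₁, B₂}}.Finite := by
  classical
  set n := Fintype.card ι with hn
  have hn0 : 0 < n := Fintype.card_pos
  have hroots : {x : k | x = 0 ∨ x ^ (2 * n) = 1}.Finite := by
    refine (Set.finite_singleton (0 : k)).union ?_
    refine (Polynomial.nthRoots (2 * n) (1 : k)).toFinset.finite_toSet.subset fun x hx => ?_
    have hx' : x ^ (2 * n) = 1 := hx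
    simpa [Polynomial.mem_nthRoots (show 0 < 2 * n by omega)] using hx'
  have hfin : {M : Matrix ι ι k | ∀ i j, M i j = 0 ∨ M i j ^ (2 * n) = 1}.Finite :=
    Set.Finite.pi' fun _ => Set.Finite.pi' fun _ => hroots
  have hinj : Function.Injective
      (fun g : V ≃ₗ[k] V => LinearMap.toMatrix e e (g.symm : V →ₗ[k] V)) := fun g h hgh =>
    LinearEquiv.symm_bijective.injective
      (LinearEquiv.toLinearMap_injective ((LinearMap.toMatrix e e).injective hgh))
  refine (hfin.preimage hinj.injOn).subset ?_
  rintro g ⟨hdet, hg₁, hg₂⟩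
  set M := LinearMap.toMatrix e e (g.symm : V →ₗ[k] V) with hM
  have hMdet : M.det = 1 := by
    have h : LinearMap.det (g.symm : V →ₗ[k] V) * LinearMap.det (g : V →ₗ[k] V) = 1 := by
      rw [← LinearMap.det_comp]
      simp
    rw [hM, LinearMap.det_toMatrix]
    rwa [hdet, mul_one] at h
  have hact (B : V →ₗ[k] V →ₗ[k] k) : LinearMap.toMatrix₂ e e (bilinFormAction g B) =
      M.transpose * LinearMap.toMatrix₂ e e B * M :=
    LinearMap.toMatrix₂_compl₁₂ e e e e B _ _
  obtain ⟨c, hc₁⟩ := Submodule.mem_span_singleton.1 hg₁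
  have h₁ : M.transpose * M = c • (1 : Matrix ι ι k) := by
    have := hact B₁
    rw [← hc₁, map_smul, hB₁, Matrix.mul_one] at this
    exact this.symm
  obtain ⟨a, b, hab⟩ := Submodule.mem_span_pair.1 hg₂
  have h₂ : M.transpose * Matrix.diagonal d * M =
      a • (1 : Matrix ι ι k) + b • Matrix.diagonal d := by
    have := hact B₂
    rw [← hab, map_add, map_smul, map_smul, hB₁, hB₂] at this
    exact this.symm
  have hcn : c ^ n = 1 := by
    have := congrArg Matrix.det h₁
    simpa [hMdet] using this.symm
  have hc : c ≠ 0 := by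
    rintro rfl
    simp [hn0.ne'] at hcn
  intro i j
  refine (entry_eq_zero_or_sq_eq hd hc h₁ h₂ i j).imp id fun h => ?_
  rw [pow_mul]
  exact h ▸ hcn

/-- A complete flag through the pencil of two diagonal forms has finite stabilizer. -/
theorem exists_completeFlag_finite_stabilizer {k V ι : Type*} [Field k] [AddCommGroup V]
    [Module k V] [Fintype ι] [Nontrivial ι] [DecidableEq ι]
    (e : Basis ι k V) {d : ι → k} (hd : Function.Injective d) {N : ℕ}
    (hN : Fintype.card (Sym2 ι) = N) :
    ∃ W : Fin (N + 1) → Submodule k (V →ₗ[k] V →ₗ[k] k),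
      (∀ i, W i ≤ symBilinForms k V) ∧
      (∀ i j, i ≤ j → W i ≤ W j) ∧
      (∀ i : Fin (N + 1), finrank k ↥(W i) = (i : ℕ)) ∧
      W (Fin.last N) = symBilinForms k V ∧
      {g : V ≃ₗ[k] V |
        LinearMap.det (g : V →ₗ[k] V) = 1 ∧
        ∀ i, bilinFormAction g '' (W i : Set (V →ₗ[k] V →ₗ[k] k)) = (W i : Set _)}.Finite := by
  let f := (symBilinForms k V).subtype.comp (symBilinFormsEquivSym2 e).symm.toLinearMap
  have hf : Function.Injective f :=
    Subtype.val_injective.comp (symBilinFormsEquivSym2 e).symm.injective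
  have hrange : LinearMap.range f = symBilinForms k V := by
    rw [LinearMap.range_comp, LinearEquiv.range, Submodule.map_top, Submodule.range_subtype]
  let x : Sym2 ι → k := Sym2.lift ⟨fun i j => (1 : Matrix ι ι k) i j, fun i j => by
    simp [Matrix.one_apply, eq_comm]⟩
  let y : Sym2 ι → k := Sym2.lift ⟨fun i j => Matrix.diagonal d i j, fun i j =>
    congrFun (congrFun (Matrix.diagonal_transpose d).symm i) j⟩
  have hx : LinearMap.toMatrix₂ e e (f x) = 1 := LinearMap.toMatrix₂_toLinearMap₂ e e _
  have hy : LinearMap.toMatrix₂ e e (f y) = Matrix.diagonal d :=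
    LinearMap.toMatrix₂_toLinearMap₂ e e _
  have hli (s t : k) (hst : s • x + t • y = 0) : s = 0 ∧ t = 0 := by
    refine smul_one_add_smul_diagonal_eq_zero hd s t (Matrix.ext fun i j => ?_)
    exact congrFun hst s(i, j)
  obtain ⟨W, hle, hmono, hrank, hlast, ⟨i, hi⟩, j, hj⟩ :=
    exists_completeFlag_through_pair hf hli ((finrank_fintype_fun_eq_card k).trans hN)
  rw [hrange] at hlast
  refine ⟨W, fun i => hrange ▸ hle i, hmono, hrank, hlast,
    (finite_stabilizer_diagonal_pencil e hd hx hy).subset ?_⟩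
  rintro g ⟨hdet, hg⟩
  refine ⟨hdet, ?_, ?_⟩
  · have h := (hg i).subset (Set.mem_image_of_mem _ (show f x ∈ W i by
      rw [hi]; exact Submodule.mem_span_singleton_self _))
    rwa [hi] at h
  · have h := (hg j).subset (Set.mem_image_of_mem _ (show f y ∈ W j by
      rw [hj]; exact Submodule.subset_span (by simp)))
    rwa [hj] at h

/-- There is a complete flag of the space of symmetric bilinear forms on `V`
(`dim V = n ≥ 2`, `k` algebraically closed of characteristic zero) whose
stabilizer in `SL(V)` is finite. -/
theorem stmt_6
    (k : Type*) [Field k] [IsAlgClosed k] [CharZero k]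
    (V : Type*) [AddCommGroup V] [Module k V] [FiniteDimensional k V]
    (n : ℕ) (hn : 2 ≤ n) (hdim : Module.finrank k V = n)
    (N : ℕ) (hN : N = n * (n + 1) / 2) :
    ∃ W : Fin (N + 1) → Submodule k (V →ₗ[k] V →ₗ[k] k),
      (∀ i, W i ≤ symBilinForms k V) ∧
      (∀ i j, i ≤ j → W i ≤ W j) ∧
      (∀ i : Fin (N + 1), Module.finrank k ↥(W i) = (i : ℕ)) ∧
      W (Fin.last N) = symBilinForms k V ∧
      {g : V ≃ₗ[k] V |
        LinearMap.det (g : V →ₗ[k] V) = 1 ∧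
        ∀ i, bilinFormAction g '' (W i : Set (V →ₗ[k] V →ₗ[k] k)) = (W i : Set _)}.Finite := by
  have : Nontrivial (Fin n) := Fin.nontrivial_iff_two_le.2 hn
  exact exists_completeFlag_finite_stabilizer (finBasisOfFinrankEq k V hdim)
    (d := fun i : Fin n => ((i : ℕ) : k)) (fun i j h => Fin.ext (Nat.cast_injective h))
    (by
      rw [Sym2.card, Fintype.card_fin, Nat.choose_two_right, Nat.add_sub_cancel, mul_comm, hN])
end

section
/- Let k be an algebraically closed field of characteristic zero and let V be a k-vector space of finite dimension n ≥ 4. Let Alt denote the k-vector space of alternating bilinear forms on V; it has dimension N = n(n−1)/2, and SL(V) acts linearly on Alt by (g·B)(x,y) = B(g⁻¹x, g⁻¹y). Then there exists a complete flag 0 = W₀ ⊂ W₁ ⊂ ⋯ ⊂ W_N = Alt of linear subspaces with dim Wᵢ = i for all i, such that the subgroup {g ∈ SL(V) : g·Wᵢ = Wᵢ for all i = 0,…,N} of SL(V) is finite. -/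
/-- The space of alternating bilinear forms on `V`, as a submodule of `V →ₗ[k] V →ₗ[k] k`. -/
def altBilinForms (k V : Type*) [Field k] [AddCommGroup V] [Module k V] :
    Submodule k (V →ₗ[k] V →ₗ[k] k) where
  carrier := {B | ∀ x : V, B x x = 0}
  add_mem' := by
    intro B₁ B₂ h₁ h₂ x
    simp [h₁ x, h₂ x]
  zero_mem' := by intro x; simp
  smul_mem' := by
    intro c B hB x
    simp [hB x]

section

open Set

section

variable {k M : Type*} [Field k] [AddCommGroup M] [Module k M]

theorem linearIndependent_of_triangular {m : ℕ} (v : Fin m → M) (f : Fin m → M →ₗ[k] k)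
    (hdiag : ∀ i, f i (v i) ≠ 0) (hlow : ∀ i j, j < i → f i (v j) = 0) :
    LinearIndependent k v := by
  rw [Fintype.linearIndependent_iff]
  intro a ha
  by_contra! hne
  classical
  obtain ⟨i₀, hi₀⟩ := hne
  obtain ⟨i, hi, hmax⟩ := (Finset.univ.filter fun i => a i ≠ 0).exists_max_image id
    ⟨i₀, by simpa using hi₀⟩
  have hsum := congrArg (f i) ha
  rw [map_sum, map_zero, Finset.sum_eq_single i] at hsum
  · simp_all
  · intro j _ hji
    rcases lt_or_gt_of_ne hji with h | h
    · simp [hlow i j h]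
    · have : a j = 0 := by
        by_contra hj
        exact absurd (hmax j (by simpa using hj)) (by simpa using h)
      simp [this]
  · simp

theorem exists_smul_sub_mem_of_image_eq {m : ℕ} {v : Fin m → M} (hv : LinearIndependent k v)
    (T : M →ₗ[k] M) (hT : Function.Injective T) (j : Fin m)
    (hlt : T '' (Submodule.span k (v '' Iio j) : Set M) = Submodule.span k (v '' Iio j))
    (hle : T '' (Submodule.span k (v '' Iic j) : Set M) = Submodule.span k (v '' Iic j)) :
    ∃ c : k, c ≠ 0 ∧ T (v j) - c • v j ∈ Submodule.span k (v '' Iio j) := by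
  have hmem : T (v j) ∈ Submodule.span k (v '' Iic j) := by
    rw [← SetLike.mem_coe, ← hle]
    exact mem_image_of_mem _ (Submodule.subset_span (mem_image_of_mem _ self_mem_Iic))
  rw [← Iio_insert, image_insert_eq, Submodule.mem_span_insert] at hmem
  obtain ⟨c, z, hz, hcz⟩ := hmem
  refine ⟨c, ?_, by simpa [hcz] using hz⟩
  rintro rfl
  rw [← SetLike.mem_coe, ← hlt] at hz
  obtain ⟨w, hw, rfl⟩ := hz
  rw [zero_smul, zero_add] at hcz
  exact hv.notMem_span_image (s := Iio j) (by simp) (hT hcz ▸ hw)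

theorem exists_basis_extending {m N : ℕ} {v : Fin m → M} (hv : LinearIndependent k v)
    [FiniteDimensional k M] (hN : Module.finrank k M = N) :
    ∃ (hm : m ≤ N) (b : Module.Basis (Fin N) k M), ∀ j, b (Fin.castLE hm j) = v j := by
  let b := Module.Basis.sumExtend hv
  have : Fintype (Module.Basis.sumExtendIndex hv) :=
    have := FiniteDimensional.fintypeBasisIndex b
    Fintype.ofInjective (Sum.inr : _ → Fin m ⊕ Module.Basis.sumExtendIndex hv) Sum.inr_injective
  have hcard := Module.finrank_eq_card_basis b
  rw [hN, Fintype.card_sum, Fintype.card_fin] at hcard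
  subst hcard
  refine ⟨Nat.le_add_right _ _, b.reindex (((Equiv.refl (Fin m)).sumCongr
    (Fintype.equivFin (Module.Basis.sumExtendIndex hv))).trans finSumFinEquiv), fun j => ?_⟩
  have : (Fin.castLE (Nat.le_add_right m _) j) =
    finSumFinEquiv (Sum.inl j : Fin m ⊕ Fin (Fintype.card (Module.Basis.sumExtendIndex hv))) := by
    rw [finSumFinEquiv_apply_left]; rfl
  rw [this, Module.Basis.reindex_apply]
  simp only [b, Module.Basis.sumExtend, Equiv.symm_trans_apply, Equiv.symm_apply_apply,
    Equiv.sumCongr_symm, Equiv.sumCongr_apply, Sum.map_inl, Module.Basis.reindex_apply,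
    Module.Basis.coe_extend]
  rfl

theorem exists_flag_extending [FiniteDimensional k M] (A : Submodule k M) {m N : ℕ}
    (hN : Module.finrank k A = N) {v : Fin m → M} (hv : LinearIndependent k v)
    (hA : ∀ j, v j ∈ A) :
    ∃ W : Fin (N + 1) → Submodule k M,
      (∀ i, W i ≤ A) ∧ (∀ i j, i ≤ j → W i ≤ W j) ∧
      (∀ i : Fin (N + 1), Module.finrank k ↥(W i) = (i : ℕ)) ∧ W (Fin.last N) = A ∧
      ∀ j, (∃ i, W i = Submodule.span k (v '' Iio j)) ∧
        ∃ i, W i = Submodule.span k (v '' Iic j) := by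
  have hv' : LinearIndependent k fun j => (⟨v j, hA j⟩ : A) :=
    LinearIndependent.of_comp A.subtype hv
  obtain ⟨hm, b, hb⟩ := exists_basis_extending hv' hN
  have hbv : ∀ j, (b (Fin.castLE hm j) : M) = v j := fun j => by rw [hb]
  have hind : LinearIndependent k fun p => (b p : M) :=
    b.linearIndependent.map' A.subtype A.ker_subtype
  have key : ∀ (i : ℕ) (s : Set (Fin m)), (∀ p, p ∈ s ↔ (p : ℕ) < i) → i ≤ m →
      (fun p => (b p : M)) '' {p : Fin N | (p : ℕ) < i} = v '' s := by
    intro i s hs hi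
    ext x
    constructor
    · rintro ⟨p, hp, rfl⟩
      exact ⟨⟨p, lt_of_lt_of_le hp hi⟩, (hs _).2 hp, (hbv _).symm⟩
    · rintro ⟨p, hp, rfl⟩
      exact ⟨Fin.castLE hm p, (hs _).1 hp, hbv _⟩
  refine ⟨fun i => Submodule.span k ((fun p => (b p : M)) '' {p : Fin N | (p : ℕ) < i}),
    fun i => ?_, fun i j hij => ?_, fun i => ?_, ?_, fun j => ⟨⟨⟨j, by omega⟩, ?_⟩,
      ⟨⟨j + 1, by omega⟩, ?_⟩⟩⟩
  · rw [Submodule.span_le]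
    rintro _ ⟨p, -, rfl⟩
    exact (b p).2
  · exact Submodule.span_mono (image_mono fun p hp => lt_of_lt_of_le (α := ℕ) hp hij)
  · have := finrank_span_eq_card (hind.comp (Subtype.val : {p : Fin N | (p : ℕ) < i} → Fin N)
      Subtype.val_injective)
    rw [range_comp, Subtype.range_coe] at this
    rw [this]
    have e := Fintype.card_congr (Equiv.setCongr (show {p : Fin N | (p : ℕ) < i} =
      range (Fin.castLE (Nat.lt_succ_iff.1 i.2)) by simp))
    rw [e, card_range_of_injective (Fin.castLE_injective _), Fintype.card_fin]
  · have : {p : Fin N | (p : ℕ) < (Fin.last N : ℕ)} = univ := by ext p; simp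
    simp only [this]
    rw [image_univ, show (fun p => (b p : M)) = A.subtype ∘ b from rfl, range_comp,
      ← Submodule.map_span, b.span_eq, Submodule.map_top, Submodule.range_subtype]
  · exact congrArg _ (key j _ (fun p => by simp) j.2.le)
  · exact congrArg _ (key (j + 1) _ (fun p => by rw [mem_Iic, Fin.le_def]; omega) j.2)

end

section

variable {k : Type*} [Field k]

/-- The two by two minor of `H` in rows `p`, `q` and columns `i`, `j`. -/
def minor (H : ℕ → ℕ → k) (p q i j : ℕ) : k := H p i * H q j - H p j * H q i

theorem minor_plucker (H : ℕ → ℕ → k) (p q a b c d : ℕ) :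
    minor H p q a b * minor H p q c d - minor H p q a c * minor H p q b d +
      minor H p q a d * minor H p q b c = 0 := by
  simp only [minor]; ring

theorem eq_zero_of_minor (H : ℕ → ℕ → k) {p q a b i : ℕ} (hab : minor H p q a b ≠ 0)
    (ha : minor H p q i a = 0) (hb : minor H p q i b = 0) : H p i = 0 ∧ H q i = 0 := by
  constructor
  · refine (mul_eq_zero.1 (?_ : minor H p q a b * H p i = 0)).resolve_left hab
    simp only [minor] at *
    linear_combination H p a * hb - H p b * ha
  · refine (mul_eq_zero.1 (?_ : minor H p q a b * H q i = 0)).resolve_left hab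
    simp only [minor] at *
    linear_combination H q a * hb - H q b * ha

theorem minor_swap (H : ℕ → ℕ → k) (p q i j : ℕ) : minor H p q j i = - minor H p q i j := by
  simp only [minor]; ring

theorem minor_eq_zero_of_path {n : ℕ} (H : ℕ → ℕ → k)
    (h1 : ∀ p, p + 1 < n → ∀ i j, j < n → i + 1 < j → minor H p (p + 1) i j = 0)
    (h2 : ∀ p q, p < q → q + 1 < n → minor H p (p + 1) q (q + 1) = 0)
    (h3 : ∀ p, p + 1 < n → minor H p (p + 1) p (p + 1) ≠ 0)
    {p i j : ℕ} (hp : p + 1 < n) (hij : i < j) (hj : j < n) (h : j ≠ i + 1 ∨ i + 1 ≠ p ∧ i ≠ p) :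
    minor H p (p + 1) i j = 0 := by
  by_cases hji : j = i + 1
  · subst hji
    rcases lt_or_ge p i with hpi | hpi
    · exact h2 p i hpi hj
    · have := minor_plucker H p (p + 1) i (i + 1) p (p + 1)
      rw [h1 p hp i (p + 1) hp (by omega), h1 p hp i p (by omega) (by omega)] at this
      simpa [h3 p hp] using this
  · exact h1 p hp i j hj (by omega)

theorem support_of_path {n : ℕ} (H : ℕ → ℕ → k)
    (h1 : ∀ p, p + 1 < n → ∀ i j, j < n → i + 1 < j → minor H p (p + 1) i j = 0)
    (h2 : ∀ p q, p < q → q + 1 < n → minor H p (p + 1) q (q + 1) = 0)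
    (h3 : ∀ p, p + 1 < n → minor H p (p + 1) p (p + 1) ≠ 0)
    {p i : ℕ} (hp : p + 1 < n) (hi : i < n) (h : i + 1 < p ∨ p + 1 < i) :
    H p i = 0 ∧ H (p + 1) i = 0 := by
  have key := @minor_eq_zero_of_path k _ n H h1 h2 h3 p
  rcases h with h | h
  · exact eq_zero_of_minor H (h3 p hp) (key hp (by omega) (by omega) (by omega))
      (key hp (by omega) (by omega) (by omega))
  · refine eq_zero_of_minor H (h3 p hp) ?_ ?_ <;> rw [minor_swap, neg_eq_zero]
    · exact key hp (by omega) hi (by omega)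
    · exact key hp (by omega) hi (by omega)

theorem diag_of_path {n : ℕ} (H : ℕ → ℕ → k)
    (h1 : ∀ p, p + 1 < n → ∀ i j, j < n → i + 1 < j → minor H p (p + 1) i j = 0)
    (h2 : ∀ p q, p < q → q + 1 < n → minor H p (p + 1) q (q + 1) = 0)
    (h3 : ∀ p, p + 1 < n → minor H p (p + 1) p (p + 1) ≠ 0)
    {p : ℕ} (hp0 : 1 ≤ p) (hp : p + 1 < n) :
    H p p ≠ 0 ∧ H (p + 1) (p + 1) ≠ 0 ∧ ∀ i, i < n → i ≠ p → H p i = 0 := by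
  obtain ⟨q, rfl⟩ : ∃ q, p = q + 1 := ⟨p - 1, by omega⟩
  have hup : ∀ q', q' + 2 < n → H (q' + 1) (q' + 2) = 0 := fun q' h =>
    (support_of_path H h1 h2 h3 (p := q') (by omega) h (by omega)).2
  have h0 := hup q hp
  have h3' := h3 (q + 1) hp
  simp only [minor, show q + 1 + 1 = q + 2 from rfl, h0, zero_mul, sub_zero] at h3'
  have hpp := left_ne_zero_of_mul h3'
  have hpp' := right_ne_zero_of_mul h3'
  refine ⟨hpp, hpp', fun i hi hip => ?_⟩
  rcases lt_or_gt_of_ne hip with h | h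
  · rcases Nat.lt_or_ge (i + 1) (q + 1) with h' | h'
    · exact (support_of_path H h1 h2 h3 hp hi (Or.inl h')).1
    · obtain rfl : i = q := by omega
      have := h1 (i + 1) hp i (i + 2) hp (by omega)
      simp only [minor, h0, zero_mul, sub_zero] at this
      exact (mul_eq_zero.1 this).resolve_right hpp'
  · exact (support_of_path H h1 h2 h3 (p := q) (by omega) hi (by omega)).2

theorem diag_of_path_of_cycle {n : ℕ} (hn : 5 ≤ n) (H : ℕ → ℕ → k)
    (h1 : ∀ p, p + 1 < n → ∀ i j, j < n → i + 1 < j → minor H p (p + 1) i j = 0)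
    (h2 : ∀ p q, p < q → q + 1 < n → minor H p (p + 1) q (q + 1) = 0)
    (h3 : ∀ p, p + 1 < n → minor H p (p + 1) p (p + 1) ≠ 0)
    (h4 : ∀ i j, j < n → i + 1 < j → (i = 0 → j ≠ n - 1) → minor H 0 (n - 1) i j = 0)
    {p i : ℕ} (hp : p < n) (hi : i < n) : H p i = 0 ↔ i ≠ p := by
  obtain ⟨m, rfl⟩ : ∃ m, n = m + 5 := ⟨n - 5, by omega⟩
  simp only [show m + 5 - 1 = m + 4 by omega] at h4
  have mid := @diag_of_path k _ _ H h1 h2 h3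
  have sup := @support_of_path k _ _ H h1 h2 h3
  have hlast : H (m + 4) (m + 4) ≠ 0 := (mid (p := m + 3) (by omega) (by omega)).2.1
  have hfirst : H 0 0 ≠ 0 := by
    have := h3 0 (by omega)
    simp only [minor, (mid (p := 1) le_rfl (by omega)).2.2 0 (by omega) (by omega)] at this
    simp only [mul_zero, sub_zero] at this
    exact left_ne_zero_of_mul this
  have h00 : ∀ j, 2 ≤ j → j < m + 5 → H 0 j = 0 := fun j hj hjn =>
    (sup (p := 0) (by omega) hjn (by omega)).1
  have hlow : ∀ j, 2 ≤ j → j < m + 4 → H (m + 4) j = 0 := fun j hj hjn => by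
    have := h4 0 j (by omega) (by omega) (by omega)
    simp only [minor, h00 j hj (by omega), zero_mul, sub_zero] at this
    exact (mul_eq_zero.1 this).resolve_left hfirst
  have hlow' : ∀ j, j < m + 4 → H (m + 4) j = 0 := fun j hjn => by
    rcases Nat.lt_or_ge j 2 with h | h
    · exact (sup (p := m + 3) (by omega) (by omega) (by omega)).2
    · exact hlow j h hjn
  have h01 : H 0 1 = 0 := by
    have := h4 1 (m + 4) (by omega) (by omega) (by omega)
    simp only [minor, h00 (m + 4) (by omega) (by omega), zero_mul, sub_zero] at this
    exact (mul_eq_zero.1 this).resolve_right hlast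
  constructor
  · rintro h rfl
    rcases Nat.eq_zero_or_pos i with rfl | h0
    · exact hfirst h
    rcases Nat.lt_or_ge (i + 1) (m + 5) with h' | h'
    · exact (mid h0 h').1 h
    · obtain rfl : i = m + 4 := by omega
      exact hlast h
  · intro hip
    rcases Nat.eq_zero_or_pos p with rfl | h0
    · rcases Nat.lt_or_ge i 2 with h | h
      · obtain rfl : i = 1 := by omega
        exact h01
      · exact h00 i h hi
    rcases Nat.lt_or_ge (p + 1) (m + 5) with h' | h'
    · exact (mid h0 h').2.2 i hi hip
    · obtain rfl : p = m + 4 := by omega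
      exact hlow' i (by omega)

theorem scalar_of_mul_eq {n : ℕ} (hn : 5 ≤ n) (t : ℕ → k) (ht : ∀ i, i < n → t i ≠ 0) {c : k}
    (hc : ∀ i j, j < n → i + 1 < j → (i = 0 → j ≠ n - 1) → t i * t j = c) {i : ℕ} (hi : i < n) :
    t i = t 0 := by
  induction i with
  | zero => rfl
  | succ i ih =>
    rw [← ih (by omega)]
    have right : ∀ j, j < n → i + 2 < j → (i = 0 → j ≠ n - 1) → t (i + 1) = t i :=
      fun j hj h h' => mul_right_cancel₀ (ht j hj)
        ((hc (i + 1) j hj (by omega) (by omega)).trans (hc i j hj (by omega) h').symm)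
    have left : ∀ j, j + 1 < i → (j = 0 → i + 1 ≠ n - 1) → t (i + 1) = t i :=
      fun j h h' => mul_left_cancel₀ (ht j (by omega))
        ((hc j (i + 1) hi (by omega) h').trans (hc j i (by omega) h (by omega)).symm)
    rcases Nat.lt_or_ge i 2 with h | h
    · exact right (i + 3) (by omega) (by omega) (by omega)
    · by_cases h' : i + 1 = n - 1
      · exact left 1 (by omega) (by omega)
      · exact left 0 (by omega) (by omega)

end

noncomputable section

variable {k V : Type*} [Field k] [AddCommGroup V] [Module k V]

/-- The action of `g` on bilinear forms as a linear map. -/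
def bilinFormActionHom (g : V ≃ₗ[k] V) : (V →ₗ[k] V →ₗ[k] k) →ₗ[k] (V →ₗ[k] V →ₗ[k] k) where
  toFun := bilinFormAction g
  map_add' _ _ := rfl
  map_smul' _ _ := rfl

theorem bilinFormActionHom_apply (g : V ≃ₗ[k] V) (B : V →ₗ[k] V →ₗ[k] k) (x y : V) :
    bilinFormActionHom g B x y = B (g.symm x) (g.symm y) := rfl

theorem bilinFormActionHom_injective (g : V ≃ₗ[k] V) :
    Function.Injective (bilinFormActionHom g) := by
  intro B C h
  ext x y
  simpa [bilinFormActionHom_apply] using LinearMap.congr_fun₂ h (g x) (g y)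

theorem mem_altBilinForms {B : V →ₗ[k] V →ₗ[k] k} :
    B ∈ altBilinForms k V ↔ ∀ x, B x x = 0 := Iff.rfl

theorem apply_swap_of_mem_altBilinForms {B : V →ₗ[k] V →ₗ[k] k} (hB : B ∈ altBilinForms k V)
    (x y : V) : B y x = - B x y := by
  have h := mem_altBilinForms.1 hB (x + y)
  simp only [map_add, LinearMap.add_apply, mem_altBilinForms.1 hB, zero_add, add_zero] at h
  exact eq_neg_of_add_eq_zero_left h

/-- The wedge product of two covectors. -/
def wedge (φ ψ : V →ₗ[k] k) : V →ₗ[k] V →ₗ[k] k := φ.smulRight ψ - ψ.smulRight φ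

theorem wedge_apply (φ ψ : V →ₗ[k] k) (x y : V) : wedge φ ψ x y = φ x * ψ y - ψ x * φ y := rfl

theorem wedge_mem (φ ψ : V →ₗ[k] k) : wedge φ ψ ∈ altBilinForms k V := fun x => by
  rw [wedge_apply]; ring

variable {n : ℕ} (b : Module.Basis (Fin n) k V)

/-- The basis vectors indexed by natural numbers, extended by zero. -/
def natVec (i : ℕ) : V := if h : i < n then b ⟨i, h⟩ else 0

/-- The coordinates indexed by natural numbers, extended by zero. -/
def natCoord (i : ℕ) : V →ₗ[k] k := if h : i < n then b.coord ⟨i, h⟩ else 0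

theorem natCoord_natVec {i j : ℕ} (hj : j < n) :
    natCoord b i (natVec b j) = if i = j then 1 else 0 := by
  simp only [natCoord, natVec, hj, dif_pos]
  split_ifs with h1 h2 h2
  · subst h2; simp
  · simp [Fin.ext_iff, Ne.symm h2]
  · omega
  · rfl

theorem natVec_coe (i : Fin n) : natVec b i = b i := by simp [natVec]

theorem natCoord_coe (i : Fin n) (x : V) : natCoord b i x = b.repr x i := by simp [natCoord]

/-- The wedge product of two basis covectors. -/
def basisWedge (i j : ℕ) : V →ₗ[k] V →ₗ[k] k := wedge (natCoord b i) (natCoord b j)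

theorem basisWedge_natVec {p q i j : ℕ} (hi : i < n) (hj : j < n) (hpq : p < q) (hij : i < j) :
    basisWedge b p q (natVec b i) (natVec b j) = if p = i ∧ q = j then 1 else 0 := by
  rw [basisWedge, wedge_apply, natCoord_natVec b hi, natCoord_natVec b hi, natCoord_natVec b hj,
    natCoord_natVec b hj]
  by_cases h1 : p = i
  · have h2 : ¬ p = j := by omega
    simp [h1]
    omega
  · by_cases h2 : q = i
    · have h3 : ¬ p = j := by omega
      simp [h1, h3]
    · simp [h1, h2]

/-- The matrix of `g⁻¹` in the given basis, indexed by natural numbers. -/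
def natMatrix (g : V ≃ₗ[k] V) (p i : ℕ) : k := natCoord b p (g.symm (natVec b i))

theorem bilinFormActionHom_basisWedge (g : V ≃ₗ[k] V) (p q i j : ℕ) :
    bilinFormActionHom g (basisWedge b p q) (natVec b i) (natVec b j) =
      minor (natMatrix b g) p q i j := by
  rw [bilinFormActionHom_apply, basisWedge, wedge_apply, minor]
  simp only [natMatrix]
  ring

theorem ext_of_mem_altBilinForms {B C : V →ₗ[k] V →ₗ[k] k} (hB : B ∈ altBilinForms k V)
    (hC : C ∈ altBilinForms k V)
    (h : ∀ i j, i < j → j < n → B (natVec b i) (natVec b j) = C (natVec b i) (natVec b j)) :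
    B = C := by
  refine b.ext fun i => b.ext fun j => ?_
  rw [← natVec_coe, ← natVec_coe]
  rcases lt_trichotomy (i : ℕ) j with hij | hij | hij
  · exact h i j hij j.2
  · rw [hij, mem_altBilinForms.1 hB, mem_altBilinForms.1 hC]
  · rw [apply_swap_of_mem_altBilinForms hB, apply_swap_of_mem_altBilinForms hC,
      h j i hij i.2]

/-- Evaluation of bilinear forms at a pair of basis vectors. -/
def coeff (i j : ℕ) : (V →ₗ[k] V →ₗ[k] k) →ₗ[k] k :=
  (LinearMap.applyₗ (natVec b j)).comp (LinearMap.applyₗ (natVec b i))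

theorem coeff_apply (i j : ℕ) (B : V →ₗ[k] V →ₗ[k] k) :
    coeff b i j B = B (natVec b i) (natVec b j) := rfl

theorem coeff_basisWedge {p q i j : ℕ} (hi : i < n) (hj : j < n) (hpq : p < q) (hij : i < j) :
    coeff b i j (basisWedge b p q) = if p = i ∧ q = j then 1 else 0 :=
  basisWedge_natVec b hi hj hpq hij

theorem finrank_altBilinForms (b : Module.Basis (Fin n) k V) :
    Module.finrank k (altBilinForms k V) = n * (n - 1) / 2 := by
  let f : altBilinForms k V →ₗ[k] ((Σ j : Fin n, Fin j) → k) :=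
    (LinearMap.pi fun p => coeff b p.2 p.1).comp (altBilinForms k V).subtype
  have hf : Function.Bijective f := by
    constructor
    · intro B C h
      refine Subtype.ext (ext_of_mem_altBilinForms b B.2 C.2 fun i j hij hj => ?_)
      exact congrFun h ⟨⟨j, hj⟩, ⟨i, hij⟩⟩
    · intro c
      refine ⟨∑ p : (Σ j : Fin n, Fin j), c p • ⟨basisWedge b p.2 p.1, wedge_mem _ _⟩, ?_⟩
      ext ⟨j, i⟩
      rw [map_sum, Finset.sum_apply]
      have hf : ∀ p : (Σ j : Fin n, Fin j), f (c p • ⟨basisWedge b p.2 p.1, wedge_mem _ _⟩) ⟨j, i⟩ =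
          c p * coeff b i j (basisWedge b p.2 p.1) := fun p => by
        rw [map_smul]; rfl
      simp only [hf]
      rw [Finset.sum_eq_single ⟨j, i⟩]
      · rw [coeff_basisWedge b (by omega) j.2 i.2 i.2]
        simp
      · rintro ⟨j', i'⟩ - hne
        rw [coeff_basisWedge b (by omega) j.2 i'.2 i.2, if_neg, mul_zero]
        rintro ⟨h1, h2⟩
        obtain rfl := Fin.ext h2
        obtain rfl := Fin.ext h1
        exact hne rfl
      · simp
  rw [(LinearEquiv.ofBijective f hf).finrank_eq, Module.finrank_fintype_fun_eq_card,
    Fintype.card_sigma, ← Finset.sum_range_id]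
  simp only [Fintype.card_fin]
  exact Fin.sum_univ_eq_sum_range (fun i => i) n

theorem finite_of_forall_smul {d : ℕ} (hd : 0 < d) (S : Set (V ≃ₗ[k] V)) (g₀ : V ≃ₗ[k] V)
    (hS : ∀ g ∈ S, ∃ t : k, t ^ d = 1 ∧ ∀ x, g.symm (g₀ x) = t • x) : S.Finite := by
  choose! t ht ht' using hS
  refine Set.Finite.of_finite_image (f := t) ?_ ?_
  · refine (Polynomial.nthRootsFinset d (1 : k)).finite_toSet.subset ?_
    rintro _ ⟨g, hg, rfl⟩
    simpa [Polynomial.mem_nthRootsFinset hd] using ht g hg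
  · intro g hg g' hg' h
    have : g.symm = g'.symm := by
      ext y
      obtain ⟨x, rfl⟩ := g₀.surjective y
      rw [ht' g hg, ht' g' hg', h]
    simpa using congrArg LinearEquiv.symm this

theorem exists_flag_of_finite [FiniteDimensional k V] {m N : ℕ}
    (hN : Module.finrank k (altBilinForms k V) = N) {v : Fin m → V →ₗ[k] V →ₗ[k] k}
    (hv : LinearIndependent k v) (hmem : ∀ j, v j ∈ altBilinForms k V)
    (hfin : {g : V ≃ₗ[k] V | LinearMap.det (g : V →ₗ[k] V) = 1 ∧ ∀ j, ∃ c : k, c ≠ 0 ∧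
      bilinFormActionHom g (v j) - c • v j ∈ Submodule.span k (v '' Iio j)}.Finite) :
    ∃ W : Fin (N + 1) → Submodule k (V →ₗ[k] V →ₗ[k] k),
      (∀ i, W i ≤ altBilinForms k V) ∧
      (∀ i j, i ≤ j → W i ≤ W j) ∧
      (∀ i : Fin (N + 1), Module.finrank k ↥(W i) = (i : ℕ)) ∧
      W (Fin.last N) = altBilinForms k V ∧
      {g : V ≃ₗ[k] V |
        LinearMap.det (g : V →ₗ[k] V) = 1 ∧
        ∀ i, bilinFormAction g '' (W i : Set (V →ₗ[k] V →ₗ[k] k)) = (W i : Set _)}.Finite := by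
  have flag := @exists_flag_extending k (V →ₗ[k] V →ₗ[k] k) _ _ _ _ (altBilinForms k V) m N
  obtain ⟨W, h1, h2, h3, h4, h5⟩ := flag hN hv hmem
  refine ⟨W, h1, h2, h3, h4, hfin.subset ?_⟩
  rintro g ⟨hdet, hg⟩
  refine ⟨hdet, fun j => ?_⟩
  obtain ⟨⟨i, hi⟩, i', hi'⟩ := h5 j
  have triangular := @exists_smul_sub_mem_of_image_eq k (V →ₗ[k] V →ₗ[k] k) _ _ _ m v
  refine triangular hv (bilinFormActionHom g) (bilinFormActionHom_injective g) j ?_ ?_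
  · rw [← hi]; exact hg i
  · rw [← hi']; exact hg i'

theorem apply_eq_of_sub_mem_span {M : Type*} [AddCommGroup M] [Module k M] {ι : Type*} {v : ι → M}
    {s : Set ι} {x y : M} (h : x - y ∈ Submodule.span k (v '' s)) (f : M →ₗ[k] k)
    (hf : ∀ i ∈ s, f (v i) = 0) : f x = f y := by
  have : Submodule.span k (v '' s) ≤ LinearMap.ker f := by
    rw [Submodule.span_le]
    rintro _ ⟨i, hi, rfl⟩
    exact hf i hi
  have := this h
  rwa [LinearMap.mem_ker, map_sub, sub_eq_zero] at this

/-- The sum of all wedge products of two distinct basis covectors, in increasing order. -/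
def sumWedge : V →ₗ[k] V →ₗ[k] k :=
  ∑ q ∈ Finset.range n, ∑ p ∈ Finset.range q, basisWedge b p q

theorem coeff_sumWedge {i j : ℕ} (hij : i < j) (hj : j < n) : coeff b i j (sumWedge b) = 1 := by
  rw [sumWedge, map_sum, Finset.sum_eq_single j, map_sum, Finset.sum_eq_single i]
  · rw [coeff_basisWedge b (by omega) hj hij hij, if_pos ⟨rfl, rfl⟩]
  · intro p hp hpi
    rw [coeff_basisWedge b (by omega) hj (Finset.mem_range.1 hp) hij, if_neg (by tauto)]
  · intro h
    exact absurd (Finset.mem_range.2 hij) h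
  · intro q _ hqj
    rw [map_sum]
    refine Finset.sum_eq_zero fun p hp => ?_
    rw [coeff_basisWedge b (by omega) hj (Finset.mem_range.1 hp) hij, if_neg (by tauto)]
  · intro h
    exact absurd (Finset.mem_range.2 hj) h

/-- The wedge products along the path `0, 1, …, n - 1`, followed by the wedge product closing the
path to a cycle, followed by `sumWedge b`. -/
def cycleForms (j : Fin (n + 1)) : V →ₗ[k] V →ₗ[k] k :=
  if (j : ℕ) + 1 < n then basisWedge b j (j + 1)
  else if (j : ℕ) + 1 = n then basisWedge b 0 (n - 1) else sumWedge b

theorem cycleForms_mem (j : Fin (n + 1)) : cycleForms b j ∈ altBilinForms k V := by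
  unfold cycleForms
  split_ifs
  · exact wedge_mem _ _
  · exact wedge_mem _ _
  · exact Submodule.sum_mem _ fun q _ => Submodule.sum_mem _ fun p _ => wedge_mem _ _

theorem coeff_cycleForms_of_lt (hn : 5 ≤ n) {j : Fin (n + 1)} {i i' : ℕ} (hj : (j : ℕ) < n)
    (hii' : i < i') (hi' : i' < n) (h : i' = i + 1 → i ≠ j)
    (h0 : (j : ℕ) + 1 = n → i = 0 → i' ≠ n - 1) :
    coeff b i i' (cycleForms b j) = 0 := by
  unfold cycleForms
  split_ifs with h1 h2
  · rw [coeff_basisWedge b (by omega) hi' (by omega) hii', if_neg (by omega)]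
  · rw [coeff_basisWedge b (by omega) hi' (by omega) hii', if_neg (by have := h0 h2; omega)]
  · omega

theorem cycleForms_path {p : ℕ} (hp : p + 1 < n) :
    cycleForms b ⟨p, by omega⟩ = basisWedge b p (p + 1) := by
  simp [cycleForms, hp]

theorem cycleForms_closing (hn : 5 ≤ n) :
    cycleForms b ⟨n - 1, by omega⟩ = basisWedge b 0 (n - 1) := by
  simp [cycleForms, show n - 1 + 1 = n by omega]

theorem cycleForms_last : cycleForms b ⟨n, by omega⟩ = sumWedge b := by
  simp [cycleForms]

theorem linearIndependent_cycleForms (hn : 5 ≤ n) : LinearIndependent k (cycleForms b) := by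
  refine linearIndependent_of_triangular
    (M := V →ₗ[k] V →ₗ[k] k) _ (fun j => if (j : ℕ) + 1 < n then coeff b j (j + 1)
    else if (j : ℕ) + 1 = n then coeff b 0 (n - 1) else coeff b 0 2) (fun j => ?_) fun j i hij => ?_
  · unfold cycleForms
    split_ifs with h1 h2
    · rw [coeff_basisWedge b (by omega) h1 (by omega) (by omega)]; simp
    · rw [coeff_basisWedge b (by omega) (by omega) (by omega) (by omega)]; simp
    · rw [coeff_sumWedge b (by omega) (by omega)]; simp
  · have hij' : (i : ℕ) < j := hij
    have hj := j.2
    split_ifs with h1 h2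
    · exact coeff_cycleForms_of_lt b hn (by omega) (by omega) h1 (by omega) (by omega)
    · exact coeff_cycleForms_of_lt b hn (by omega) (by omega) (by omega) (by omega) (by omega)
    · exact coeff_cycleForms_of_lt b hn (by omega) (by omega) (by omega) (by omega) (by omega)

theorem minor_of_diag {H : ℕ → ℕ → k} (hH : ∀ p i, p < n → i < n → (H p i = 0 ↔ i ≠ p))
    {p q i j : ℕ} (hpq : p < q) (hq : q < n) (hij : i < j) (hj : j < n) :
    minor H p q i j = if p = i ∧ q = j then H i i * H j j else 0 := by
  have hoff : ∀ p i, p < n → i < n → i ≠ p → H p i = 0 := fun p i hp hi h => (hH p i hp hi).2 h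
  have h2 : H p j * H q i = 0 := by
    by_cases h : j = p
    · rw [hoff q i hq (by omega) (by omega), mul_zero]
    · rw [hoff p j (by omega) hj h, zero_mul]
  rw [minor, h2, sub_zero]
  split_ifs with h
  · rw [h.1, h.2]
  · by_cases h1 : i = p
    · rw [hoff q j hq hj (by rintro rfl; exact h ⟨h1.symm, rfl⟩), mul_zero]
    · rw [hoff p i (by omega) (by omega) h1, zero_mul]

theorem coeff_action_sumWedge (g : V ≃ₗ[k] V)
    (hH : ∀ p i, p < n → i < n → (natMatrix b g p i = 0 ↔ i ≠ p)) {i j : ℕ} (hij : i < j)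
    (hj : j < n) : coeff b i j (bilinFormActionHom g (sumWedge b)) =
      natMatrix b g i i * natMatrix b g j j := by
  have hterm : ∀ q ∈ Finset.range n, ∀ p ∈ Finset.range q,
      coeff b i j (bilinFormActionHom g (basisWedge b p q)) =
        if p = i ∧ q = j then natMatrix b g i i * natMatrix b g j j else 0 := fun q hq p hp => by
    rw [coeff_apply, bilinFormActionHom_basisWedge]
    exact minor_of_diag hH (Finset.mem_range.1 hp) (Finset.mem_range.1 hq) hij hj
  rw [sumWedge, map_sum, map_sum, Finset.sum_eq_single j, map_sum, map_sum,
    Finset.sum_eq_single i]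
  · rw [hterm j (Finset.mem_range.2 hj) i (Finset.mem_range.2 hij), if_pos ⟨rfl, rfl⟩]
  · intro p hp hpi
    rw [hterm j (Finset.mem_range.2 hj) p hp, if_neg (by tauto)]
  · intro h
    exact absurd (Finset.mem_range.2 hij) h
  · intro q hq hqj
    rw [map_sum, map_sum]
    refine Finset.sum_eq_zero fun p hp => ?_
    rw [hterm q hq p hp, if_neg (by tauto)]
  · intro h
    exact absurd (Finset.mem_range.2 hj) h

theorem symm_apply_eq_smul_of_natMatrix (g : V ≃ₗ[k] V) {t : k}
    (hH : ∀ p i, p < n → i < n → natMatrix b g p i = if p = i then t else 0) (x : V) :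
    g.symm x = t • x := by
  suffices h : (g.symm : V →ₗ[k] V) = t • LinearMap.id from LinearMap.congr_fun h x
  refine b.ext fun i => b.repr.injective (Finsupp.ext fun p => ?_)
  have := hH p i p.2 i.2
  rw [natMatrix, natVec_coe, natCoord_coe] at this
  simp only [LinearEquiv.coe_coe, this, LinearMap.smul_apply, LinearMap.id_apply, map_smul,
    Module.Basis.repr_self, Finsupp.smul_apply, Finsupp.single_apply, Fin.ext_iff]
  simp [eq_comm]

theorem pow_eq_one_of_symm_apply_eq_smul (b : Module.Basis (Fin n) k V) (g : V ≃ₗ[k] V)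
    (hdet : LinearMap.det (g : V →ₗ[k] V) = 1) {t : k} (h : ∀ x, g.symm x = t • x) :
    t ^ n = 1 := by
  have h1 : (g.symm : V →ₗ[k] V) = t • LinearMap.id := LinearMap.ext h
  have h2 := LinearEquiv.det_symm_mul_det g
  rw [hdet, mul_one, h1, LinearMap.det_smul, LinearMap.det_id, mul_one,
    Module.finrank_eq_card_basis b, Fintype.card_fin] at h2
  exact h2

theorem symm_eq_smul_of_cycleForms (hn : 5 ≤ n) (g : V ≃ₗ[k] V)
    (hg : ∀ j, ∃ c : k, c ≠ 0 ∧ bilinFormActionHom g (cycleForms b j) - c • cycleForms b j ∈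
      Submodule.span k (cycleForms b '' Iio j)) :
    ∃ t : k, ∀ x, g.symm x = t • x := by
  choose c hc0 hc using hg
  have key : ∀ (j : Fin (n + 1)) (i i' : ℕ),
      (∀ l < j, coeff b i i' (cycleForms b l) = 0) →
      coeff b i i' (bilinFormActionHom g (cycleForms b j)) =
        c j * coeff b i i' (cycleForms b j) := fun j i i' h => by
    have := apply_eq_of_sub_mem_span (M := V →ₗ[k] V →ₗ[k] k) (hc j) (coeff b i i') h
    rwa [map_smul, smul_eq_mul] at this
  have hpath : ∀ (p : ℕ) (hp : p + 1 < n) (i i' : ℕ), i < i' → i' < n → (i' = i + 1 → p ≤ i) →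
      minor (natMatrix b g) p (p + 1) i i' =
        c ⟨p, by omega⟩ * if p = i ∧ p + 1 = i' then 1 else 0 := fun p hp i i' hii' hi' h => by
    rw [← coeff_basisWedge b (by omega) hi' (by omega) hii', ← bilinFormActionHom_basisWedge,
      ← coeff_apply, ← cycleForms_path b hp]
    refine key _ _ _ fun l hl => ?_
    have hl' : (l : ℕ) < p := hl
    exact coeff_cycleForms_of_lt b hn (by omega) hii' hi' (by omega) (by omega)
  have hdiag := @diag_of_path_of_cycle k _ n hn (natMatrix b g)
    (fun p hp i j hj hij => by
      rw [hpath p hp i j (by omega) hj (by omega), if_neg (by omega), mul_zero])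
    (fun p q hpq hq => by
      rw [hpath p (by omega) q (q + 1) (by omega) hq (by omega), if_neg (by omega), mul_zero])
    (fun p hp => by
      rw [hpath p hp p (p + 1) (by omega) hp (by omega), if_pos ⟨rfl, rfl⟩, mul_one]
      exact hc0 _)
    (fun i j hj hij hne => by
      rw [← bilinFormActionHom_basisWedge, ← coeff_apply, ← cycleForms_closing b hn, key,
        cycleForms_closing b hn, coeff_basisWedge b (by omega) hj (by omega) (by omega),
        if_neg (by omega), mul_zero]
      intro l hl
      have hl' : (l : ℕ) < n - 1 := hl
      exact coeff_cycleForms_of_lt b hn (by omega) (by omega) hj (by omega) (by omega))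
  have hdiag' : ∀ p i, p < n → i < n → (natMatrix b g p i = 0 ↔ i ≠ p) :=
    fun p i hp hi => hdiag hp hi
  have hscalar := @scalar_of_mul_eq k _ n hn (fun i => natMatrix b g i i)
    (fun i hi h => (hdiag hi hi).1 h rfl) (c ⟨n, by omega⟩) fun i j hj hij hne => by
      rw [← coeff_action_sumWedge b g hdiag' (by omega) hj, ← cycleForms_last b, key,
        cycleForms_last, coeff_sumWedge b (by omega) hj, mul_one]
      intro l hl
      have hl' : (l : ℕ) < n := hl
      exact coeff_cycleForms_of_lt b hn hl' (by omega) hj (by omega) (by omega)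
  refine ⟨natMatrix b g 0 0, symm_apply_eq_smul_of_natMatrix b g fun p i hp hi => ?_⟩
  split_ifs with h
  · subst h
    exact hscalar hp
  · exact (hdiag' p i hp hi).2 (Ne.symm h)

theorem eq_smul_of_orthogonal {M : Type*} [AddCommGroup M] [Module k M] {m : ℕ} {v : Fin m → M}
    (P : M →ₗ[k] M →ₗ[k] k) (hoff : ∀ i j, i ≠ j → P (v i) (v j) = 0)
    (hdiag : ∀ i, P (v i) (v i) ≠ 0) (T : M →ₗ[k] M)
    (hT : ∀ i j, P (T (v i)) (T (v j)) = P (v i) (v j)) {c : Fin m → k} (hc0 : ∀ j, c j ≠ 0)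
    (hc : ∀ j, T (v j) - c j • v j ∈ Submodule.span k (v '' Iio j)) (j : Fin m) :
    T (v j) = c j • v j := by
  induction j using WellFoundedLT.induction with
  | _ j ih =>
    have hw : ∀ i < j, P (v i) (T (v j) - c j • v j) = 0 := fun i hi => by
      have h := hT i j
      rw [ih i hi, hoff i j hi.ne, map_smul, LinearMap.smul_apply, smul_eq_mul,
        mul_eq_zero] at h
      rw [map_sub, map_smul, hoff i j hi.ne, h.resolve_left (hc0 i), smul_zero, sub_zero]
    obtain ⟨l, hl, hlw⟩ := (Finsupp.mem_span_image_iff_linearCombination k).1 (hc j)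
    have hl0 : l = 0 := by
      ext i
      by_cases hi : i < j
      · have h := hw i hi
        rw [← hlw, Finsupp.linearCombination_apply, Finsupp.sum_fintype _ _ (by simp), map_sum,
          Finset.sum_eq_single i, map_smul, smul_eq_mul] at h
        · exact (mul_eq_zero.1 h).resolve_right (hdiag i)
        · intro i' _ hi'
          rw [map_smul, hoff i i' hi'.symm, smul_zero]
        · simp
      · by_contra h
        exact hi (hl (Finsupp.mem_support_iff.2 h))
    rw [hl0, map_zero] at hlw
    exact sub_eq_zero.1 hlw.symm

theorem apply_eq_self_of_add_of_sub {M : Type*} [AddCommGroup M] [Module k M] (h2 : (2 : k) ≠ 0)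
    (T : M →ₗ[k] M) {x y : M} (hadd : T (x + y) = x + y) (hsub : T (x - y) = x - y) :
    T x = x ∧ T y = y := by
  have hx : T x = x := by
    have h : (2 : k) • T x = (2 : k) • x := by
      rw [two_smul, two_smul]
      calc T x + T x = T (x + y) + T (x - y) := by rw [map_add, map_sub]; abel
        _ = x + x := by rw [hadd, hsub]; abel
    exact smul_right_injective M h2 h
  refine ⟨hx, ?_⟩
  rw [map_add, hx] at hadd
  exact add_left_cancel hadd

theorem eq_smul_of_minor {H : ℕ → ℕ → k}
    (h : ∀ p q i j, p < 4 → q < 4 → i < 4 → j < 4 → minor H p q i j =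
      (if p = i then 1 else 0) * (if q = j then 1 else 0) -
        (if q = i then 1 else 0) * (if p = j then 1 else 0)) :
    ∃ t : k, t ^ 2 = 1 ∧ ∀ p i, p < 4 → i < 4 → H p i = if p = i then t else 0 := by
  have hoff : ∀ p i, p < 4 → i < 4 → p ≠ i → H p i = 0 := fun p i hp hi hpi => by
    obtain ⟨q, hq, hqp, hqi⟩ : ∃ q < 4, q ≠ p ∧ q ≠ i := by
      by_contra! hcon
      have h0 := hcon 0
      have h1 := hcon 1
      have h2 := hcon 2
      omega
    refine (eq_zero_of_minor H (p := p) (q := q) (a := p) (b := q) (i := i) ?_ ?_ ?_).1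
    · simp [h p q p q hp hq hp hq, hqp]
    · simp [h p q i p hp hq hi hp, hqi, hqp]
    · simp [h p q i q hp hq hi hq, hpi, hqp.symm]
  have hdiag : ∀ p q, p < 4 → q < 4 → p ≠ q → H p p * H q q = 1 := fun p q hp hq hpq => by
    have := h p q p q hp hq hp hq
    simpa [minor, hoff p q hp hq hpq, hpq.symm] using this
  have h01 := hdiag 0 1 (by norm_num) (by norm_num) (by norm_num)
  have h02 := hdiag 0 2 (by norm_num) (by norm_num) (by norm_num)
  have h12 := hdiag 1 2 (by norm_num) (by norm_num) (by norm_num)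
  have hsq : H 0 0 ^ 2 = 1 := by
    linear_combination (H 0 0) ^ 2 * (-h12) + (H 0 0 * H 2 2) * h01 + h02
  refine ⟨H 0 0, hsq, fun p i hp hi => ?_⟩
  split_ifs with hpi
  · subst hpi
    rcases Nat.eq_zero_or_pos p with rfl | h0
    · rfl
    · have := hdiag 0 p (by norm_num) hp (by omega)
      linear_combination H 0 0 * this - H p p * hsq
  · exact hoff p i hp hi hpi

theorem add_sub_mem {M : Type*} [AddCommGroup M] [Module k M] {p : Submodule k M} {x y : M}
    (hx : x ∈ p) (hy : y ∈ p) : x + y ∈ p ∧ x - y ∈ p := ⟨add_mem hx hy, sub_mem hx hy⟩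

section

variable (e : Module.Basis (Fin 4) k V)

/-- The polarization of the Pfaffian of bilinear forms on a four-dimensional space. -/
def pfaffianPairing : (V →ₗ[k] V →ₗ[k] k) →ₗ[k] (V →ₗ[k] V →ₗ[k] k) →ₗ[k] k :=
  LinearMap.mk₂ k (fun B C => coeff e 0 1 B * coeff e 2 3 C + coeff e 2 3 B * coeff e 0 1 C -
      (coeff e 0 2 B * coeff e 1 3 C + coeff e 1 3 B * coeff e 0 2 C) +
      (coeff e 0 3 B * coeff e 1 2 C + coeff e 1 2 B * coeff e 0 3 C))
    (fun B B' C => by simp only [map_add]; ring)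
    (fun c B C => by simp only [map_smul, smul_eq_mul]; ring)
    (fun B C C' => by simp only [map_add]; ring)
    (fun c B C => by simp only [map_smul, smul_eq_mul]; ring)

theorem pfaffianPairing_apply (B C : V →ₗ[k] V →ₗ[k] k) : pfaffianPairing e B C =
    coeff e 0 1 B * coeff e 2 3 C + coeff e 2 3 B * coeff e 0 1 C -
      (coeff e 0 2 B * coeff e 1 3 C + coeff e 1 3 B * coeff e 0 2 C) +
      (coeff e 0 3 B * coeff e 1 2 C + coeff e 1 2 B * coeff e 0 3 C) := rfl

/-- An orthogonal basis of the space of alternating forms with respect to the Pfaffian. -/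
def pfaffianForms : Fin 6 → V →ₗ[k] V →ₗ[k] k :=
  ![basisWedge e 0 1 + basisWedge e 2 3, basisWedge e 0 1 - basisWedge e 2 3,
    basisWedge e 0 2 + basisWedge e 1 3, basisWedge e 0 2 - basisWedge e 1 3,
    basisWedge e 0 3 + basisWedge e 1 2, basisWedge e 0 3 - basisWedge e 1 2]

theorem pfaffianForms_mem (j : Fin 6) : pfaffianForms e j ∈ altBilinForms k V := by
  have key := @add_sub_mem k _ (V →ₗ[k] V →ₗ[k] k) _ _ (altBilinForms k V)
  have h : ∀ p q p' q', basisWedge e p q + basisWedge e p' q' ∈ altBilinForms k V ∧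
    basisWedge e p q - basisWedge e p' q' ∈ altBilinForms k V :=
    fun p q p' q' => key (wedge_mem _ _) (wedge_mem _ _)
  fin_cases j
  exacts [(h _ _ _ _).1, (h _ _ _ _).2, (h _ _ _ _).1, (h _ _ _ _).2, (h _ _ _ _).1,
    (h _ _ _ _).2]

theorem coeff_sub {n : ℕ} (b : Module.Basis (Fin n) k V) (i j : ℕ) (B C : V →ₗ[k] V →ₗ[k] k) :
    coeff b i j (B - C) = coeff b i j B - coeff b i j C := rfl

theorem bilinFormActionHom_sub (g : V ≃ₗ[k] V) (B C : V →ₗ[k] V →ₗ[k] k) :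
    bilinFormActionHom g (B - C) = bilinFormActionHom g B - bilinFormActionHom g C := rfl

theorem pfaffianPairing_pfaffianForms (i j : Fin 6) :
    pfaffianPairing e (pfaffianForms e i) (pfaffianForms e j) =
      if i = j then ![2, -2, -2, 2, 2, -2] i else 0 := by
  fin_cases i <;> fin_cases j <;>
    simp [pfaffianPairing_apply, pfaffianForms, coeff_sub, coeff_basisWedge] <;> norm_num

theorem coeff_action_basisWedge (g : V ≃ₗ[k] V) (p q i j : ℕ) :
    coeff e i j (bilinFormActionHom g (basisWedge e p q)) = minor (natMatrix e g) p q i j := by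
  rw [coeff_apply, bilinFormActionHom_basisWedge]

theorem det_symm_eq (g : V ≃ₗ[k] V) : LinearMap.det (g.symm : V →ₗ[k] V) =
    minor (natMatrix e g) 0 1 0 1 * minor (natMatrix e g) 2 3 2 3
      + minor (natMatrix e g) 0 1 2 3 * minor (natMatrix e g) 2 3 0 1
      - (minor (natMatrix e g) 0 1 0 2 * minor (natMatrix e g) 2 3 1 3
        + minor (natMatrix e g) 0 1 1 3 * minor (natMatrix e g) 2 3 0 2)
      + (minor (natMatrix e g) 0 1 0 3 * minor (natMatrix e g) 2 3 1 2
        + minor (natMatrix e g) 0 1 1 2 * minor (natMatrix e g) 2 3 0 3) := by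
  have : LinearMap.toMatrix e e (g.symm : V →ₗ[k] V) =
      Matrix.of fun i j : Fin 4 => natMatrix e g i j := by
    ext i j
    rw [LinearMap.toMatrix_apply, Matrix.of_apply, natMatrix, natVec_coe, natCoord_coe]
    rfl
  rw [← LinearMap.det_toMatrix e, this]
  simp [Matrix.det_succ_row_zero, Fin.sum_univ_succ, Fin.succAbove, minor]
  ring

set_option maxHeartbeats 2000000 in
theorem pfaffianPairing_action (g : V ≃ₗ[k] V) (i j : Fin 6) :
    pfaffianPairing e (bilinFormActionHom g (pfaffianForms e i))
        (bilinFormActionHom g (pfaffianForms e j)) =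
      LinearMap.det (g.symm : V →ₗ[k] V) *
        pfaffianPairing e (pfaffianForms e i) (pfaffianForms e j) := by
  rw [pfaffianPairing_pfaffianForms, det_symm_eq e]
  generalize hH : natMatrix e g = H
  fin_cases i <;> fin_cases j <;>
    simp [pfaffianPairing_apply, pfaffianForms, coeff_sub, bilinFormActionHom_sub,
      coeff_action_basisWedge, hH, minor] <;> ring

theorem pfaffianPairing_pfaffianForms_of_ne {i j : Fin 6} (h : i ≠ j) :
    pfaffianPairing e (pfaffianForms e i) (pfaffianForms e j) = 0 := by
  rw [pfaffianPairing_pfaffianForms, if_neg h]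

end

section

variable [CharZero k] (e : Module.Basis (Fin 4) k V)

theorem pfaffianPairing_pfaffianForms_self (j : Fin 6) :
    pfaffianPairing e (pfaffianForms e j) (pfaffianForms e j) ≠ 0 := by
  rw [pfaffianPairing_pfaffianForms, if_pos rfl]
  fin_cases j <;> simp

theorem linearIndependent_pfaffianForms : LinearIndependent k (pfaffianForms e) := by
  have key := @linearIndependent_of_triangular k (V →ₗ[k] V →ₗ[k] k) _ _ _ 6 (pfaffianForms e)
    (fun i => pfaffianPairing e (pfaffianForms e i))
  exact key (fun j => pfaffianPairing_pfaffianForms_self e j)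
    fun i j h => pfaffianPairing_pfaffianForms_of_ne e h.ne'

theorem action_pfaffianForms_eq_smul (g : V ≃ₗ[k] V) (hdet : LinearMap.det (g : V →ₗ[k] V) = 1)
    {c : Fin 6 → k} (hc0 : ∀ j, c j ≠ 0)
    (hc : ∀ j, bilinFormActionHom g (pfaffianForms e j) - c j • pfaffianForms e j ∈
      Submodule.span k (pfaffianForms e '' Iio j)) (j : Fin 6) :
    bilinFormActionHom g (pfaffianForms e j) = c j • pfaffianForms e j ∧ c j ^ 2 = 1 := by
  have hdet' := LinearEquiv.det_symm_mul_det g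
  rw [hdet, mul_one] at hdet'
  have hT : ∀ i j, pfaffianPairing e (bilinFormActionHom g (pfaffianForms e i))
      (bilinFormActionHom g (pfaffianForms e j)) =
        pfaffianPairing e (pfaffianForms e i) (pfaffianForms e j) := fun i j => by
    rw [pfaffianPairing_action, hdet', one_mul]
  have key := @eq_smul_of_orthogonal k _ (V →ₗ[k] V →ₗ[k] k) _ _ 6 (pfaffianForms e)
    (pfaffianPairing e)
  have h := key (fun i j => pfaffianPairing_pfaffianForms_of_ne e)
    (pfaffianPairing_pfaffianForms_self e) (bilinFormActionHom g) hT hc0 hc j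
  refine ⟨h, ?_⟩
  have h' := hT j j
  rw [h, map_smul, map_smul, LinearMap.smul_apply, smul_eq_mul, smul_eq_mul, ← mul_assoc] at h'
  have := mul_right_cancel₀ (pfaffianPairing_pfaffianForms_self e j) (h'.trans (one_mul _).symm)
  rw [sq, this]

theorem action_basisWedge_eq_self (f : V ≃ₗ[k] V)
    (hf : ∀ j, bilinFormActionHom f (pfaffianForms e j) = pfaffianForms e j) {p q : ℕ}
    (hp : p < 4) (hq : q < 4) :
    bilinFormActionHom f (basisWedge e p q) = basisWedge e p q := by
  have key := @apply_eq_self_of_add_of_sub k _ (V →ₗ[k] V →ₗ[k] k) _ _ two_ne_zero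
    (bilinFormActionHom f)
  have h1 := key (hf 0) (hf 1)
  have h2 := key (hf 2) (hf 3)
  have h3 := key (hf 4) (hf 5)
  have hlt : ∀ p q, p < q → q < 4 →
      bilinFormActionHom f (basisWedge e p q) = basisWedge e p q := fun p q hpq hq => by
    interval_cases q <;> interval_cases p
    exacts [h1.1, h2.1, h3.2, h3.1, h2.2, h1.2]
  have hswap : ∀ p q x y, basisWedge e p q x y = - basisWedge e q p x y := fun p q x y => by
    simp only [basisWedge, wedge_apply]
    ring
  ext x y
  rw [bilinFormActionHom_apply]
  rcases lt_trichotomy p q with h | rfl | h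
  · exact LinearMap.congr_fun₂ (hlt p q h hq) x y
  · simp only [basisWedge, wedge_apply, sub_self]
  · rw [hswap p q, hswap p q]
    exact congrArg Neg.neg (LinearMap.congr_fun₂ (hlt q p h hp) x y)

theorem symm_eq_smul_of_pfaffianForms (f : V ≃ₗ[k] V)
    (hf : ∀ j, bilinFormActionHom f (pfaffianForms e j) = pfaffianForms e j) :
    ∃ t : k, t ^ 2 = 1 ∧ ∀ x, f.symm x = t • x := by
  have hminor := @eq_smul_of_minor k _ (natMatrix e f) fun p q i j hp hq hi hj => by
    rw [← bilinFormActionHom_basisWedge, action_basisWedge_eq_self e f hf hp hq, basisWedge,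
      wedge_apply, natCoord_natVec e hi, natCoord_natVec e hi, natCoord_natVec e hj,
      natCoord_natVec e hj]
  obtain ⟨t, ht, h⟩ := hminor
  exact ⟨t, ht, symm_apply_eq_smul_of_natMatrix e f h⟩

theorem finite_setOf_pfaffianForms :
    {g : V ≃ₗ[k] V | LinearMap.det (g : V →ₗ[k] V) = 1 ∧ ∀ j, ∃ c : k, c ≠ 0 ∧
      bilinFormActionHom g (pfaffianForms e j) - c • pfaffianForms e j ∈
        Submodule.span k (pfaffianForms e '' Iio j)}.Finite := by
  have hfin : (Set.univ.pi fun _ : Fin 6 => ({1, -1} : Set k)).Finite :=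
    Set.Finite.pi fun _ => Set.toFinite _
  refine (hfin.biUnion (t := fun c => {g : V ≃ₗ[k] V |
    ∀ j, bilinFormActionHom g (pfaffianForms e j) = c j • pfaffianForms e j})
    fun c hc => ?_).subset ?_
  · rcases Set.eq_empty_or_nonempty {g : V ≃ₗ[k] V |
      ∀ j, bilinFormActionHom g (pfaffianForms e j) = c j • pfaffianForms e j} with h | ⟨g₀, hg₀⟩
    · rw [h]
      exact Set.finite_empty
    · refine finite_of_forall_smul two_pos _ g₀ fun g hg => ?_
      refine symm_eq_smul_of_pfaffianForms e (g.trans g₀.symm) fun j => ?_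
      have h := (hg j).trans (hg₀ j).symm
      ext x y
      have := LinearMap.congr_fun₂ h (g₀ x) (g₀ y)
      rw [bilinFormActionHom_apply, bilinFormActionHom_apply, g₀.symm_apply_apply,
        g₀.symm_apply_apply] at this
      exact this
  · rintro g ⟨hdet, hg⟩
    choose c hc0 hc using hg
    have h := action_pfaffianForms_eq_smul e g hdet hc0 hc
    refine Set.mem_biUnion (x := c) ?_ fun j => (h j).1
    exact fun j _ => by simpa using (h j).2

end

theorem finite_setOf_cycleForms {n : ℕ} (b : Module.Basis (Fin n) k V) (hn : 5 ≤ n) :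
    {g : V ≃ₗ[k] V | LinearMap.det (g : V →ₗ[k] V) = 1 ∧ ∀ j, ∃ c : k, c ≠ 0 ∧
      bilinFormActionHom g (cycleForms b j) - c • cycleForms b j ∈
        Submodule.span k (cycleForms b '' Iio j)}.Finite := by
  refine finite_of_forall_smul (show 0 < n by omega) _ (LinearEquiv.refl k V) ?_
  rintro g ⟨hdet, hg⟩
  obtain ⟨t, ht⟩ := symm_eq_smul_of_cycleForms b hn g hg
  exact ⟨t, pow_eq_one_of_symm_apply_eq_smul b g hdet ht, ht⟩

end

end

/-- There is a complete flag of the space of alternating bilinear forms on `V`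
(`dim V = n ≥ 4`, `k` algebraically closed of characteristic zero) whose
stabilizer in `SL(V)` is finite. -/
theorem stmt_7
    (k : Type*) [Field k] [IsAlgClosed k] [CharZero k]
    (V : Type*) [AddCommGroup V] [Module k V] [FiniteDimensional k V]
    (n : ℕ) (hn : 4 ≤ n) (hdim : Module.finrank k V = n)
    (N : ℕ) (hN : N = n * (n - 1) / 2) :
    ∃ W : Fin (N + 1) → Submodule k (V →ₗ[k] V →ₗ[k] k),
      (∀ i, W i ≤ altBilinForms k V) ∧
      (∀ i j, i ≤ j → W i ≤ W j) ∧
      (∀ i : Fin (N + 1), Module.finrank k ↥(W i) = (i : ℕ)) ∧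
      W (Fin.last N) = altBilinForms k V ∧
      {g : V ≃ₗ[k] V |
        LinearMap.det (g : V →ₗ[k] V) = 1 ∧
        ∀ i, bilinFormAction g '' (W i : Set (V →ₗ[k] V →ₗ[k] k)) = (W i : Set _)}.Finite := by
  have b := Module.finBasisOfFinrankEq k V hdim
  have hrank := (finrank_altBilinForms b).trans hN.symm
  rcases hn.eq_or_lt with rfl | hn5
  · exact exists_flag_of_finite hrank (linearIndependent_pfaffianForms b) (pfaffianForms_mem b)
      (finite_setOf_pfaffianForms b)
  · exact exists_flag_of_finite hrank (linearIndependent_cycleForms b hn5) (cycleForms_mem b)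
      (finite_setOf_cycleForms b hn5)
end
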